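/- arXiv:2512.08464 — 2 statements merged into one kernel-verified Lean document; each statement's English description precedes it below -/
import Mathlib

section
/- Let γ ≥ 1 be a real quantization gain and x ∈ ℝ with 0 < γ|x| < 1/2, and let x̆ = s(x)·rnd(γ|x|)/γ with s(x) = 1 if x ≥ 0 and s(x) = −1 if x < 0. Then 1/(2γ) < |x̆ − x| < 1/γ. -/
/-- The modified rounding function: `rnd σ = ⌊σ + 1/2⌋` if `σ ≥ 1/2`, else `1`. -/
noncomputable def rnd (σ : ℝ) : ℤ := if σ ≥ 1/2 then ⌊σ + 1/2⌋ else 1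

/-- The sign `s(x)`: `1` if `x ≥ 0`, `−1` if `x < 0`. -/
noncomputable def qsign (x : ℝ) : ℝ := if 0 ≤ x then 1 else -1

/-- The dequantized value `x̆ = s(x) · rnd(γ|x|)/γ`. -/
noncomputable def dequant (γ x : ℝ) : ℝ := qsign x * (rnd (γ * |x|) : ℝ) / γ

/-- Below the rounding threshold, the quantization error is `(1 − γ|x|)/γ`. -/
theorem abs_dequant_sub_of_lt_half {γ x : ℝ} (hγ : 0 < γ) (hx : γ * |x| < 1/2) :
    |dequant γ x - x| = (1 - γ * |x|) / γ := by
  have hrnd : rnd (γ * |x|) = 1 := if_neg (not_le.mpr hx)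
  have hsign : |qsign x| = 1 := by unfold qsign; split_ifs <;> simp
  have hmul : qsign x * |x| = x := by
    unfold qsign
    split_ifs with h
    · rw [abs_of_nonneg h, one_mul]
    · rw [abs_of_neg (not_le.mp h), neg_one_mul, neg_neg]
  have hfactor : dequant γ x - x = qsign x * ((1 - γ * |x|) / γ) := by
    have hdequant : dequant γ x = qsign x / γ := by simp [dequant, hrnd]
    rw [hdequant]
    nth_rewrite 2 [← hmul]
    field_simp
  rw [hfactor, abs_mul, hsign, one_mul, abs_of_pos (div_pos (by linarith) hγ)]

/-- If `γ ≥ 1` and `0 < γ|x| < 1/2`, then `1/(2γ) < |x̆ − x| < 1/γ`. -/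
theorem quant_error_bounds_of_lt_half (γ x : ℝ) (hγ : 1 ≤ γ)
    (hx0 : 0 < γ * |x|) (hx : γ * |x| < 1/2) :
    1 / (2 * γ) < |dequant γ x - x| ∧ |dequant γ x - x| < 1 / γ := by
  have hpos : 0 < γ := by linarith
  rw [abs_dequant_sub_of_lt_half hpos hx]
  constructor
  · rw [← div_div]
    gcongr
    linarith
  · gcongr
    linarith
end

section
/- Let E ∈ ℝ^{nN}, W ∈ ℝ^{nN×n}, Ψ := WᵀW positive definite with smallest eigenvalue λ_min(Ψ) > 0, let γ ≥ 1 be a real quantization gain, m a positive natural number (the number of encrypted factors), and q a real number. If q − rnd(γ^m · ‖E‖_max‖W‖_max / λ_min(Ψ)) > 1/2, then for all indices i ∈ {1,…,nN} and l, ι ∈ {1,…,n}, the quantized multiplicative term satisfies rnd(γ^m · |E_i · W_{il} · (Ψ⁻¹)_{lι}|) < q − 1/2 (i.e., no overflow occurs for these terms). -/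
/-- The modified rounding function is monotone. -/
theorem rnd_mono : Monotone rnd := by
  intro a b hab
  unfold rnd
  split_ifs with ha hb hb
  · exact Int.floor_le_floor (by linarith)
  · exact absurd (ha.trans hab) hb
  · rw [Int.le_floor]
    push_cast
    linarith
  · exact le_rfl

namespace Matrix

variable {n : Type*} [Fintype n] [DecidableEq n] {A : Matrix n n ℝ}

/-- The entries of the inverse of a positive definite matrix in terms of its spectral
decomposition. -/
theorem PosDef.inv_apply_eq_sum (hA : A.PosDef) (l k : n) :
    A⁻¹ l k = ∑ j, (hA.isHermitian.eigenvectorUnitary : Matrix n n ℝ) l j *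
      (hA.isHermitian.eigenvalues j)⁻¹ *
      (hA.isHermitian.eigenvectorUnitary : Matrix n n ℝ) k j := by
  set U : Matrix n n ℝ := (hA.isHermitian.eigenvectorUnitary : Matrix n n ℝ) with hU
  set d := hA.isHermitian.eigenvalues with hd
  have hUU : U * star U = 1 := Unitary.mul_star_self_of_mem hA.isHermitian.eigenvectorUnitary.2
  have hUU' : star U * U = 1 := Unitary.star_mul_self_of_mem hA.isHermitian.eigenvectorUnitary.2
  have hspec : A = U * diagonal d * star U := by
    have := hA.isHermitian.spectral_theorem
    rw [Unitary.conjStarAlgAut_apply] at this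
    exact this
  have hdd : diagonal d * diagonal (fun j => (d j)⁻¹) = 1 := by
    rw [diagonal_mul_diagonal, ← diagonal_one]
    congr 1
    ext j
    exact mul_inv_cancel₀ (hA.eigenvalues_pos j).ne'
  have hinv : A⁻¹ = U * diagonal (fun j => (d j)⁻¹) * star U := by
    apply inv_eq_right_inv
    calc A * (U * diagonal (fun j => (d j)⁻¹) * star U)
        = U * diagonal d * (star U * U) * diagonal (fun j => (d j)⁻¹) * star U := by
          conv_lhs => rw [hspec]
          simp only [Matrix.mul_assoc]
      _ = 1 := by
          rw [hUU', Matrix.mul_one, Matrix.mul_assoc U, hdd, Matrix.mul_one, hUU]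
  rw [hinv, mul_apply]
  simp [mul_diagonal, star_apply]

/-- The entries of the inverse of a positive definite matrix are bounded by the inverse of any
positive lower bound of its eigenvalues. -/
theorem PosDef.abs_inv_apply_le (hA : A.PosDef) {c : ℝ} (hc : 0 < c)
    (hle : ∀ j, c ≤ hA.isHermitian.eigenvalues j) (l k : n) : |A⁻¹ l k| ≤ c⁻¹ := by
  rw [hA.inv_apply_eq_sum]
  set U : Matrix n n ℝ := (hA.isHermitian.eigenvectorUnitary : Matrix n n ℝ) with hU
  set d := hA.isHermitian.eigenvalues with hd
  have hUU : U * star U = 1 := Unitary.mul_star_self_of_mem hA.isHermitian.eigenvectorUnitary.2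
  have hrow (i : n) : ∑ j, U i j ^ 2 = 1 := by
    have := congrFun (congrFun hUU i) i
    simpa [mul_apply, star_apply, sq] using this
  calc |∑ j, U l j * (d j)⁻¹ * U k j|
      ≤ ∑ j, |U l j * (d j)⁻¹ * U k j| := Finset.abs_sum_le_sum_abs _ _
    _ ≤ ∑ j, c⁻¹ * ((U l j ^ 2 + U k j ^ 2) / 2) := by
        refine Finset.sum_le_sum fun j _ => ?_
        have hdc : (d j)⁻¹ ≤ c⁻¹ := inv_anti₀ hc (hle j)
        have hd0 : 0 ≤ (d j)⁻¹ := inv_nonneg.2 (hc.le.trans (hle j))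
        have hprod : |U l j| * |U k j| ≤ (U l j ^ 2 + U k j ^ 2) / 2 := by
          rw [← sq_abs (U l j), ← sq_abs (U k j)]
          linarith [two_mul_le_add_sq |U l j| |U k j|]
        rw [abs_mul, abs_mul, abs_of_nonneg hd0, mul_right_comm, mul_comm]
        exact mul_le_mul hdc hprod (by positivity) (inv_nonneg.2 hc.le)
    _ = c⁻¹ := by
        rw [← Finset.mul_sum, ← Finset.sum_div, Finset.sum_add_distrib, hrow, hrow]
        ring

end Matrix

open Matrix in
/-- If `q − rnd(γ^m · ‖E‖_max‖W‖_max / λ_min(Ψ)) > 1/2` with `Ψ := WᵀW` positive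
definite and `γ ≥ 1`, then every quantized multiplicative term satisfies
`rnd(γ^m · |E_i · W_{il} · (Ψ⁻¹)_{lι}|) < q − 1/2`, i.e. no overflow occurs. -/
theorem cfrit_no_overflow (n N : ℕ) (hn : 0 < n) (hN : 0 < N)
    (E : Fin (n * N) → ℝ) (W : Matrix (Fin (n * N)) (Fin n) ℝ)
    (hΨ : (Wᵀ * W).PosDef)
    (γ : ℝ) (hγ : 1 ≤ γ) (m : ℕ) (hm : 0 < m) (q : ℝ)
    (hq : q - (rnd (γ ^ m *
        ((⨆ i' : Fin (n * N), |E i'|) * (⨆ p : Fin (n * N) × Fin n, |W p.1 p.2|) /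
          (⨅ j : Fin n, hΨ.isHermitian.eigenvalues j))) : ℝ) > 1/2) :
    ∀ (i : Fin (n * N)) (l ι : Fin n),
      (rnd (γ ^ m * |E i * W i l * (Wᵀ * W)⁻¹ l ι|) : ℝ) < q - 1/2 := by
  intro i l ι
  have : Nonempty (Fin n) := ⟨⟨0, hn⟩⟩
  set c := ⨅ j : Fin n, hΨ.isHermitian.eigenvalues j with hc_def
  have hc : 0 < c := by
    obtain ⟨j, hj⟩ := exists_eq_ciInf_of_finite (f := hΨ.isHermitian.eigenvalues)
    rw [hc_def, ← hj]
    exact hΨ.eigenvalues_pos j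
  have hE : |E i| ≤ ⨆ i' : Fin (n * N), |E i'| :=
    le_ciSup (f := fun i' => |E i'|) (Set.finite_range _).bddAbove i
  have hW : |W i l| ≤ ⨆ p : Fin (n * N) × Fin n, |W p.1 p.2| :=
    le_ciSup (f := fun p : Fin (n * N) × Fin n => |W p.1 p.2|) (Set.finite_range _).bddAbove (i, l)
  have hinv : |(Wᵀ * W)⁻¹ l ι| ≤ c⁻¹ :=
    hΨ.abs_inv_apply_le hc (fun j => ciInf_le (Set.finite_range _).bddBelow j) l ι
  have hE0 := (abs_nonneg (E i)).trans hE
  have hW0 := (abs_nonneg (W i l)).trans hW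
  have hrnd := rnd_mono (show γ ^ m * |E i * W i l * (Wᵀ * W)⁻¹ l ι| ≤ γ ^ m *
      ((⨆ i' : Fin (n * N), |E i'|) * (⨆ p : Fin (n * N) × Fin n, |W p.1 p.2|) / c) by
    rw [abs_mul, abs_mul, div_eq_mul_inv]
    gcongr)
  have hrnd' := (Int.cast_le (R := ℝ)).2 hrnd
  linarith
end
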